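/- arXiv:1710.09493 — 2 statements merged into one kernel-verified Lean document; each statement's English description precedes it below -/
import Mathlib

section
/- Let d ≥ 1 and set p = ⌈log₂(d + 2)⌉. Let F be a finite family of separated d-intervals such that every p members of F have a common point. Then F has a piercing set of at most d points. -/
/-- `S` is a separated `d`-interval: a nonempty subset of `Fin d × ℝ` whose slice over
each of the `d` parallel lines is a (possibly empty) closed bounded interval. -/
def IsSeparatedDInterval (d : ℕ) (S : Set (Fin d × ℝ)) : Prop :=
  S.Nonempty ∧ ∀ i : Fin d,
    (∃ a b : ℝ, a ≤ b ∧ {y : ℝ | (i, y) ∈ S} = Set.Icc a b) ∨ {y : ℝ | (i, y) ∈ S} = ∅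


lemma collision_card {α β : Type*} [DecidableEq α] [DecidableEq β] (A : Finset α) (f : α → β)
    (B : Finset β) (h : A.image f = B) (hc : A.card = B.card + 1) :
    (A.filter (fun a => (A.erase a).image f = B)).card = 2 := by
  obtain ⟨x, hx, y, hy, hxy, hf⟩ := Finset.exists_ne_map_eq_of_card_lt_of_maps_to
    (s := A) (t := B) (f := f) (by omega) (by
      intro a ha
      have : f a ∈ A.image f := Finset.mem_image_of_mem f ha
      rw [h] at this
      exact_mod_cast this)
  have key : ∀ x ∈ A, ∀ y ∈ A, x ≠ y → f x = f y → (A.erase x).image f = B := by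
    intro x hx y hy hxy hf
    rw [← h]
    ext b
    simp only [Finset.mem_image, Finset.mem_erase]
    constructor
    · rintro ⟨a, ⟨_, h2⟩, h3⟩
      exact ⟨a, h2, h3⟩
    · rintro ⟨a, h2, h3⟩
      by_cases hax : a = x
      · exact ⟨y, ⟨hxy.symm, hy⟩, by rw [← hf, ← hax, h3]⟩
      · exact ⟨a, ⟨hax, h2⟩, h3⟩
  have : A.filter (fun a => (A.erase a).image f = B) = {x, y} := by
    ext a
    simp only [Finset.mem_filter, Finset.mem_insert, Finset.mem_singleton]
    constructor
    · rintro ⟨ha, hB⟩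
      by_contra hne
      push Not at hne
      have hinj : Set.InjOn f (A.erase a : Finset α) := by
        rw [← Finset.card_image_iff, hB, Finset.card_erase_of_mem ha]
        omega
      exact hxy (hinj (by simp [hx, hne.1.symm]) (by simp [hy, hne.2.symm]) hf)
    · rintro (rfl | rfl)
      · exact ⟨hx, key _ hx _ hy hxy hf⟩
      · exact ⟨hy, key _ hy _ hx hxy.symm hf.symm⟩
  rw [this, Finset.card_pair hxy]

section Scarf

set_option linter.unusedSectionVars false

variable {I Y α : Type*} [Fintype I] [DecidableEq I] [Fintype Y] [DecidableEq Y] [LinearOrder α]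

/-- Dominant sets in the sense of Scarf. -/
def ScarfDom (u : I → Y → α) (S : Finset Y) : Prop := ∀ z, ∃ i, ∀ y ∈ S, u i z ≤ u i y

lemma ScarfDom.mono {u : I → Y → α} {S T : Finset Y} (h : ScarfDom u S) (hT : T ⊆ S) :
    ScarfDom u T := fun z => by
  obtain ⟨i, hi⟩ := h z
  exact ⟨i, fun y hy => hi y (hT hy)⟩

open Classical in
lemma scarf_rooms (u : I → Y → α) (hu : ∀ i, Function.Injective (u i)) (T : Finset Y)
    (hT : ScarfDom u T) (hcard : T.card + 1 = Fintype.card I) (m : I → Y)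
    (hm1 : ∀ i, m i ∈ T) (hm2 : ∀ i, ∀ y ∈ T, u i (m i) ≤ u i y) :
    (Finset.univ.filter (fun x => x ∉ T ∧ ScarfDom u (insert x T))).card =
    (Finset.univ.filter (fun a : I => (Finset.univ.erase a).image m = T ∧
      ∃ z, ∀ b, b ≠ a → u b (m b) < u b z)).card := by
  symm
  -- the property: x is a maximiser for a
  have hex : ∀ a : I, (∃ z, ∀ b, b ≠ a → u b (m b) < u b z) →
      ∃ x, (∀ b, b ≠ a → u b (m b) < u b x) ∧
        ∀ z, (∀ b, b ≠ a → u b (m b) < u b z) → u a z ≤ u a x := by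
    rintro a ⟨z, hz⟩
    obtain ⟨x, hx, hx2⟩ := Finset.exists_max_image
      (Finset.univ.filter (fun z => ∀ b, b ≠ a → u b (m b) < u b z)) (u a) ⟨z, by simpa using hz⟩
    refine ⟨x, by simpa using hx, fun w hw => hx2 w (by simpa using hw)⟩
  have hY : Nonempty Y := by
    have : 0 < Fintype.card I := by omega
    obtain ⟨i⟩ := Fintype.card_pos_iff.mp this
    exact ⟨m i⟩
  choose! g hg1 hg2 using hex
  refine Finset.card_bij (fun a _ => g a) ?_ ?_ ?_
  · intro a ha
    simp only [Finset.mem_filter, Finset.mem_univ, true_and] at ha ⊢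
    obtain ⟨ha1, ha2⟩ := ha
    have h1 := hg1 a ha2
    have h2 := hg2 a ha2
    constructor
    · intro hmem
      rw [← ha1] at hmem
      simp only [Finset.mem_image, Finset.mem_erase, Finset.mem_univ, and_true] at hmem
      obtain ⟨b, hb, hb2⟩ := hmem
      have := h1 b hb
      rw [hb2] at this
      exact lt_irrefl _ this
    · intro z
      by_cases hz : ∀ b, b ≠ a → u b (m b) < u b z
      · obtain ⟨e, he⟩ := hT z
        have hea : e = a := by
          by_contra hne
          exact absurd (he _ (hm1 e)) (not_le.mpr (hz e hne))
        subst hea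
        refine ⟨e, fun y hy => ?_⟩
        rcases Finset.mem_insert.mp hy with rfl | hy
        · exact h2 z hz
        · exact he y hy
      · push Not at hz
        obtain ⟨b, hb, hz⟩ := hz
        refine ⟨b, fun y hy => ?_⟩
        rcases Finset.mem_insert.mp hy with rfl | hy
        · exact hz.trans (h1 b hb).le
        · exact hz.trans (hm2 b y hy)
  · intro a ha a' ha' heq
    simp only [Finset.mem_filter, Finset.mem_univ, true_and] at ha ha'
    by_contra hne
    obtain ⟨e, he⟩ := hT (g a)
    have h3 := he _ (hm1 e)
    by_cases hea : e = a
    · have := hg1 a' ha'.2 e (by rw [hea]; exact hne)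
      rw [← heq] at this
      exact absurd h3 (not_le.mpr this)
    · exact absurd h3 (not_le.mpr (hg1 a ha.2 e hea))
  · intro x hx
    simp only [Finset.mem_filter, Finset.mem_univ, true_and] at hx
    obtain ⟨hxT, hxD⟩ := hx
    have hmin : ∀ y : {y // y ∈ insert x T}, ∃ i, ∀ y' ∈ insert x T, u i y ≤ u i y' :=
      fun y => hxD y
    choose k hk using hmin
    have hkinj : Function.Injective k := by
      intro y y' h
      have h1 := hk y y' y'.2
      have h2 := hk y' y y.2
      rw [← h] at h2
      exact Subtype.ext (hu _ (le_antisymm h1 h2))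
    have hkbij : Function.Bijective k := by
      rw [Fintype.bijective_iff_injective_and_card]
      refine ⟨hkinj, ?_⟩
      rw [Fintype.card_coe, Finset.card_insert_of_notMem hxT, hcard]
    have hx0 : x ∈ insert x T := Finset.mem_insert_self _ _
    set a := k ⟨x, hx0⟩ with ha
    have hother : ∀ y (hy : y ∈ T), m (k ⟨y, Finset.mem_insert_of_mem hy⟩) = y := by
      intro y hy
      apply hu (k ⟨y, Finset.mem_insert_of_mem hy⟩)
      exact le_antisymm (hm2 _ y hy) (hk ⟨y, Finset.mem_insert_of_mem hy⟩ _
        (Finset.mem_insert_of_mem (hm1 _)))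
    have hane : ∀ y (hy : y ∈ T), k ⟨y, Finset.mem_insert_of_mem hy⟩ ≠ a := by
      intro y hy h
      have := congrArg Subtype.val (hkinj h)
      simp only at this
      exact hxT (this ▸ hy)
    have hMx : ∀ b, b ≠ a → u b (m b) < u b x := by
      intro b hb
      obtain ⟨⟨y, hy⟩, rfl⟩ := hkbij.2 b
      have hyx : y ≠ x := by
        rintro rfl
        exact hb rfl
      have hyT : y ∈ T := (Finset.mem_insert.mp hy).resolve_left hyx
      rw [hother y hyT]
      refine lt_of_le_of_ne (hk ⟨y, hy⟩ x hx0) ?_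
      intro h
      exact hyx (hu _ h)
    refine ⟨a, ?_, ?_⟩
    · simp only [Finset.mem_filter, Finset.mem_univ, true_and]
      refine ⟨?_, x, hMx⟩
      ext y
      simp only [Finset.mem_image, Finset.mem_erase, Finset.mem_univ, and_true]
      constructor
      · rintro ⟨b, _, rfl⟩
        exact hm1 b
      · intro hy
        exact ⟨_, hane y hy, hother y hy⟩
    · have h1 := hg1 a ⟨x, hMx⟩
      have h2 := hg2 a ⟨x, hMx⟩
      apply hu a
      refine le_antisymm ?_ (h2 x hMx)
      obtain ⟨e, he⟩ := hxD (g a)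
      have hea : e = a := by
        by_contra hne
        exact absurd (he _ (Finset.mem_insert_of_mem (hm1 e))) (not_le.mpr (h1 e hne))
      rw [hea] at he
      exact he x hx0

open Classical in
theorem scarf (hI : 2 ≤ Fintype.card I) (u : I → Y → α) (hu : ∀ i, Function.Injective (u i))
    (e : I → Y) (hs1 : ∀ i y, y ≠ e i → u i (e i) < u i y)
    (hs2 : ∀ i j, j ≠ i → ∀ y, y ∉ Set.range e → u j y < u j (e i))
    (y0 : Y) (hy0 : y0 ∉ Set.range e) (c : Y → I) (hce : ∀ i, c (e i) = i) :
    ∃ S : Finset Y, ScarfDom u S ∧ S.image c = Finset.univ := by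
  by_contra hno
  push Not at hno
  obtain ⟨i0⟩ : Nonempty I := Fintype.card_pos_iff.mp (by omega)
  have heinj : Function.Injective e := fun i j h => by rw [← hce i, h, hce j]
  have hE : (Finset.univ.erase i0 : Finset I).card + 1 = Fintype.card I := by
    rw [Finset.card_erase_of_mem (Finset.mem_univ _), Finset.card_univ]; omega
  set Rm : Finset (Finset Y) := Finset.univ.filter (fun S => ScarfDom u S ∧
    S.card = Fintype.card I ∧ S.image c = Finset.univ.erase i0) with hRm
  set Dr : Finset (Finset Y) := Finset.univ.filter (fun T => ScarfDom u T ∧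
    T.card + 1 = Fintype.card I ∧ T.image c = Finset.univ.erase i0) with hDr
  set T0 : Finset Y := (Finset.univ.erase i0).image e with hT0
  have hT0mem : T0 ∈ Dr := by
    simp only [hDr, Finset.mem_filter, Finset.mem_univ, true_and]
    refine ⟨?_, ?_, ?_⟩
    · intro z
      by_cases hz : z ∈ Set.range e
      · obtain ⟨b, rfl⟩ := hz
        refine ⟨b, fun y _ => ?_⟩
        by_cases hy : y = e b
        · rw [hy]
        · exact (hs1 b y hy).le
      · refine ⟨i0, fun y hy => ?_⟩
        simp only [hT0, Finset.mem_image, Finset.mem_erase, Finset.mem_univ, and_true] at hy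
        obtain ⟨j, hj, rfl⟩ := hy
        exact (hs2 j i0 hj.symm z hz).le
    · rw [hT0, Finset.card_image_of_injective _ heinj, hE]
    · rw [hT0, Finset.image_image]
      have : c ∘ e = id := funext hce
      rw [this, Finset.image_id]
  have hdc := Finset.sum_card_bipartiteAbove_eq_sum_card_bipartiteBelow
    (s := Rm) (t := Dr) (fun S T => T ⊆ S)
  -- each room has two doors
  have hroom : ∀ S ∈ Rm, (Finset.bipartiteAbove (fun S T => T ⊆ S) Dr S).card = 2 := by
    intro S hS
    simp only [hRm, Finset.mem_filter, Finset.mem_univ, true_and] at hS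
    obtain ⟨hSD, hSc, hSi⟩ := hS
    rw [← collision_card S c _ hSi (by omega)]
    symm
    refine Finset.card_bij (fun x _ => S.erase x) ?_ ?_ ?_
    · intro x hx
      simp only [Finset.mem_filter] at hx
      simp only [Finset.bipartiteAbove, hDr, Finset.mem_filter, Finset.mem_univ, true_and]
      refine ⟨⟨hSD.mono (Finset.erase_subset _ _), ?_, hx.2⟩, Finset.erase_subset _ _⟩
      rw [Finset.card_erase_of_mem hx.1]; omega
    · intro x hx x' hx' h
      simp only [Finset.mem_filter] at hx hx'
      exact (Finset.erase_inj S hx.1).mp h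
    · intro T hT
      simp only [Finset.bipartiteAbove, hDr, Finset.mem_filter, Finset.mem_univ, true_and] at hT
      obtain ⟨⟨_, hTc, hTi⟩, hTS⟩ := hT
      obtain ⟨x, hx⟩ : ∃ x, S \ T = {x} := by
        rw [← Finset.card_eq_one, Finset.card_sdiff_of_subset hTS]; omega
      have hxm : x ∈ S \ T := by rw [hx]; simp
      have hST : S.erase x = T := by
        rw [Finset.erase_eq, ← hx, Finset.sdiff_sdiff_eq_self hTS]
      refine ⟨x, ?_, hST⟩
      simp only [Finset.mem_filter]
      exact ⟨(Finset.mem_sdiff.mp hxm).1, by rw [hST, hTi]⟩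
  -- number of rooms of a door
  have hdoor : ∀ T ∈ Dr, (Finset.bipartiteBelow (fun S T => T ⊆ S) Rm T).card =
      (Finset.univ.filter (fun x => x ∉ T ∧ ScarfDom u (insert x T))).card := by
    intro T hT
    simp only [hDr, Finset.mem_filter, Finset.mem_univ, true_and] at hT
    obtain ⟨hTD, hTc, hTi⟩ := hT
    symm
    refine Finset.card_bij (fun x _ => insert x T) ?_ ?_ ?_
    · intro x hx
      simp only [Finset.mem_filter, Finset.mem_univ, true_and] at hx
      simp only [Finset.bipartiteBelow, hRm, Finset.mem_filter, Finset.mem_univ, true_and]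
      refine ⟨⟨hx.2, ?_, ?_⟩, Finset.subset_insert _ _⟩
      · rw [Finset.card_insert_of_notMem hx.1, hTc]
      · rw [Finset.image_insert, hTi]
        apply Finset.insert_eq_self.mpr
        simp only [Finset.mem_erase, Finset.mem_univ, and_true]
        intro hc
        apply hno _ hx.2
        rw [Finset.image_insert, hTi, hc, Finset.insert_erase (Finset.mem_univ _)]
    · intro x hx x' hx' h
      simp only [Finset.mem_filter, Finset.mem_univ, true_and] at hx hx'
      have : x ∈ insert x' T := by rw [← show insert x T = insert x' T from h]; simp
      exact (Finset.mem_insert.mp this).resolve_right hx.1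
    · intro S hS
      simp only [Finset.bipartiteBelow, hRm, Finset.mem_filter, Finset.mem_univ, true_and] at hS
      obtain ⟨⟨hSD, hSc, hSi⟩, hTS⟩ := hS
      obtain ⟨x, hx⟩ : ∃ x, S \ T = {x} := by
        rw [← Finset.card_eq_one, Finset.card_sdiff_of_subset hTS]; omega
      have hxm : x ∈ S \ T := by rw [hx]; simp
      have hST : insert x T = S := by
        rw [Finset.insert_eq, ← hx, Finset.sdiff_union_of_subset hTS]
      refine ⟨x, ?_, hST⟩
      simp only [Finset.mem_filter, Finset.mem_univ, true_and]
      exact ⟨(Finset.mem_sdiff.mp hxm).2, by rw [hST]; exact hSD⟩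
  -- minima
  have hmins : ∀ T ∈ Dr, ∃ m : I → Y, (∀ i, m i ∈ T) ∧ (∀ i, ∀ y ∈ T, u i (m i) ≤ u i y) ∧
      (Finset.univ : Finset I).image m = T := by
    intro T hT
    simp only [hDr, Finset.mem_filter, Finset.mem_univ, true_and] at hT
    obtain ⟨hTD, hTc, hTi⟩ := hT
    have hne : T.Nonempty := by
      rw [← Finset.card_pos]; omega
    have := fun i => Finset.exists_min_image T (u i) hne
    choose m hm1 hm2 using this
    refine ⟨m, hm1, hm2, ?_⟩
    ext y
    simp only [Finset.mem_image, Finset.mem_univ, true_and]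
    constructor
    · rintro ⟨i, rfl⟩; exact hm1 i
    · intro hy
      obtain ⟨i, hi⟩ := hTD y
      exact ⟨i, hu i (le_antisymm (hm2 i y hy) (hi _ (hm1 i)))⟩
  have hdoor2 : ∀ T ∈ Dr, T ≠ T0 → (Finset.bipartiteBelow (fun S T => T ⊆ S) Rm T).card = 2 := by
    intro T hT hTne
    rw [hdoor T hT]
    obtain ⟨m, hm1, hm2, hm3⟩ := hmins T hT
    simp only [hDr, Finset.mem_filter, Finset.mem_univ, true_and] at hT
    obtain ⟨hTD, hTc, hTi⟩ := hT
    rw [scarf_rooms u hu T hTD hTc m hm1 hm2,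
      ← collision_card Finset.univ m T hm3 (by rw [Finset.card_univ, hTc])]
    congr 1
    ext a
    simp only [Finset.mem_filter, Finset.mem_univ, true_and, and_iff_left_iff_imp]
    intro _
    obtain ⟨t, htT, ht⟩ : ∃ t ∈ T, t ∉ Set.range e := by
      by_contra hcon
      push Not at hcon
      apply hTne
      apply Finset.eq_of_subset_of_card_le
      · intro t ht
        obtain ⟨i, rfl⟩ := hcon t ht
        have : c (e i) ∈ T.image c := Finset.mem_image_of_mem c ht
        rw [hTi, hce] at this
        exact Finset.mem_image_of_mem e this
      · rw [hT0, Finset.card_image_of_injective _ heinj]; omega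
    exact ⟨e a, fun b hb => (hm2 b t htT).trans_lt (hs2 a b hb t ht)⟩
  have hdoor1 : (Finset.bipartiteBelow (fun S T => T ⊆ S) Rm T0).card = 1 := by
    rw [hdoor T0 hT0mem]
    obtain ⟨m, hm1, hm2, hm3⟩ := hmins T0 hT0mem
    have hT := hT0mem
    simp only [hDr, Finset.mem_filter, Finset.mem_univ, true_and] at hT
    obtain ⟨hTD, hTc, hTi⟩ := hT
    rw [scarf_rooms u hu T0 hTD hTc m hm1 hm2, Finset.card_eq_one]
    have hmemT0 : ∀ b, b ≠ i0 → e b ∈ T0 := fun b hb =>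
      Finset.mem_image_of_mem e (by simp [hb])
    have hme : ∀ b, b ≠ i0 → m b = e b := by
      intro b hb
      by_contra hne
      exact absurd (hm2 b (e b) (hmemT0 b hb)) (not_le.mpr (hs1 b _ hne))
    have hmT : ∀ b, ∃ j, j ≠ i0 ∧ m b = e j := by
      intro b
      have := hm1 b
      simp only [hT0, Finset.mem_image, Finset.mem_erase, Finset.mem_univ, and_true] at this
      obtain ⟨j, hj, h⟩ := this
      exact ⟨j, hj, h.symm⟩
    refine ⟨i0, ?_⟩
    ext a
    simp only [Finset.mem_filter, Finset.mem_univ, true_and, Finset.mem_singleton]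
    constructor
    · rintro ⟨ha, z, hz⟩
      by_contra hne
      have hz0 := hz i0 (Ne.symm hne)
      obtain ⟨j, hj, hmj⟩ := hmT i0
      rw [hmj] at hz0
      have hzr : z ∈ Set.range e := by
        by_contra hzr
        exact lt_asymm hz0 (hs2 j i0 hj.symm z hzr)
      obtain ⟨b, rfl⟩ := hzr
      have hb0 : b ≠ i0 := by
        rintro rfl
        exact lt_asymm hz0 (hs1 b _ (fun h => hj (heinj h)))
      have hba : b = a := by
        by_contra hba
        have := hz b hba
        rw [hme b hb0] at this
        exact lt_irrefl _ this
      subst hba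
      have := hmemT0 b hb0
      rw [← ha] at this
      simp only [Finset.mem_image, Finset.mem_erase, Finset.mem_univ, and_true] at this
      obtain ⟨b', hb', h⟩ := this
      have h2 := hz b' hb'
      rw [h] at h2
      exact lt_irrefl _ h2
    · rintro rfl
      refine ⟨?_, y0, fun b hb => ?_⟩
      · rw [hT0]
        apply Finset.image_congr
        intro b hb
        exact hme b (by simpa using hb)
      · rw [hme b hb]
        exact hs1 b y0 (fun h => hy0 ⟨b, h.symm⟩)
  rw [Finset.sum_congr rfl hroom, ← Finset.add_sum_erase _ _ hT0mem, hdoor1,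
    Finset.sum_congr rfl (fun T hT => hdoor2 T (Finset.mem_of_mem_erase hT)
      (Finset.ne_of_mem_erase hT))] at hdc
  simp only [Finset.sum_const, smul_eq_mul] at hdc
  omega

end Scarf

section Brouwer

variable {I : Type*} [Fintype I] [DecidableEq I]

open Classical in
lemma brouwer_grid (hI : 2 ≤ Fintype.card I) (N : ℕ)
    (c : (I → ℕ) → I) :
    ∃ (m : I → ℕ) (S : Set (I → ℕ)), S.Nonempty ∧
      (∀ x ∈ S, ∑ i, x i = N ∧ ∀ i, m i ≤ x i ∧ x i ≤ m i + Fintype.card I) ∧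
      ∀ i, (∃ x ∈ S, c x = i) ∨ m i = 0 := by
  let X := {x : I → Fin (N + 1) // ∑ i, (x i : ℕ) = N}
  let Y := X ⊕ I
  let enc : Y ≃ Fin (Fintype.card Y) := Fintype.equivFin Y
  let v : I → Y → ℕ := fun i y => Sum.elim (fun x : X => (x.1 i : ℕ) + 1)
    (fun j => if j = i then 0 else N + 2) y
  let u : I → Y → ℕ ×ₗ ℕ := fun i y => toLex (v i y, (enc y : ℕ))
  have hlt : ∀ i y y', v i y < v i y' → u i y < u i y' := by
    intro i y y' h
    rw [Prod.Lex.toLex_lt_toLex]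
    exact Or.inl h
  have hle : ∀ i y y', u i y ≤ u i y' → v i y ≤ v i y' := by
    intro i y y' h
    by_contra hc
    exact absurd h (not_le.mpr (hlt i y' y (not_le.mp hc)))
  obtain ⟨k0⟩ : Nonempty I := Fintype.card_pos_iff.mp (by omega)
  -- building grid points
  have hmk : ∀ z : I → ℕ, ∑ i, z i = N → ∃ x : X, ∀ i, (x.1 i : ℕ) = z i := by
    intro z hz
    have hzi : ∀ i, z i < N + 1 := by
      intro i
      have := Finset.single_le_sum (f := z) (fun i _ => Nat.zero_le _) (Finset.mem_univ i)
      omega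
    exact ⟨⟨fun i => ⟨z i, hzi i⟩, hz⟩, fun i => rfl⟩
  have hval : ∀ (x : X) i, (x.1 i : ℕ) ≤ N := fun x i => by
    have := (x.1 i).2; omega
  obtain ⟨x0, hx0⟩ := hmk (fun i => if i = k0 then N else 0) (by simp)
  let cc : Y → I := fun y => Sum.elim (fun x : X => c (fun i => (x.1 i : ℕ))) (fun j => j) y
  obtain ⟨S, hSD, hSc⟩ := scarf hI u (by
      intro i y y' h
      have h2 : (v i y, (enc y : ℕ)) = (v i y', (enc y' : ℕ)) := toLex.injective h
      exact enc.injective (Fin.ext (Prod.mk.inj h2).2))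
    (fun i => (Sum.inr i : Y))
    (by
      intro i y hy
      apply hlt
      rcases y with x | j
      · simp [v]
      · have : j ≠ i := fun h => hy (by rw [h])
        simp [v, this])
    (by
      intro i j hj y hy
      apply hlt
      rcases y with x | k
      · have := hval x j
        simp only [v, Sum.elim_inl, Sum.elim_inr, if_neg hj.symm]
        omega
      · exact absurd ⟨k, rfl⟩ hy)
    (Sum.inl x0) (by simp) cc (fun i => rfl)
  -- claim A
  have hA : ∀ z : X, ∃ i, (Sum.inr i : Y) ∉ S ∧ ∀ x : X, (Sum.inl x : Y) ∈ S →
      (z.1 i : ℕ) ≤ x.1 i := by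
    intro z
    obtain ⟨i, hi⟩ := hSD (Sum.inl z)
    refine ⟨i, fun h => ?_, fun x hx => ?_⟩
    · have := hle _ _ _ (hi _ h)
      simp [v] at this
    · have := hle _ _ _ (hi _ hx)
      simpa [v] using this
  have hB : ∀ i, (Sum.inr i : Y) ∉ S → ∃ x : X, (Sum.inl x : Y) ∈ S ∧
      c (fun i => (x.1 i : ℕ)) = i := by
    intro i hi
    have : i ∈ S.image cc := by rw [hSc]; simp
    obtain ⟨y, hy, hyi⟩ := Finset.mem_image.mp this
    rcases y with x | j
    · exact ⟨x, hy, hyi⟩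
    · have : j = i := hyi
      exact absurd (this ▸ hy) hi
  obtain ⟨i1, hi1, -⟩ := hA x0
  have hmin : ∀ i, ∃ k : ℕ, (∀ x : X, (Sum.inl x : Y) ∈ S → k ≤ x.1 i) ∧
      ∃ x : X, (Sum.inl x : Y) ∈ S ∧ (x.1 i : ℕ) = k := by
    intro i
    obtain ⟨x1, hx1, -⟩ := hB i1 hi1
    obtain ⟨x, hx, hx2⟩ := Finset.exists_min_image
      (Finset.univ.filter (fun x : X => (Sum.inl x : Y) ∈ S)) (fun x => (x.1 i : ℕ))
      ⟨x1, by simpa using hx1⟩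
    exact ⟨x.1 i, fun y hy => hx2 y (by simpa using hy), x, by simpa using hx, rfl⟩
  choose k hk1 hk2 using hmin
  let m : I → ℕ := fun i => if (Sum.inr i : Y) ∈ S then 0 else k i
  have hm1 : ∀ x : X, (Sum.inl x : Y) ∈ S → ∀ i, m i ≤ x.1 i := by
    intro x hx i
    by_cases h : (Sum.inr i : Y) ∈ S
    · simp [m, h]
    · simpa [m, h] using hk1 i x hx
  have hsum : N < ∑ i, m i + Fintype.card I := by
    by_contra hcon
    push Not at hcon
    let z0 : I → ℕ := fun i => if (Sum.inr i : Y) ∈ S then 0 else k i + 1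
    have hz0 : ∑ i, z0 i ≤ N := by
      calc ∑ i, z0 i ≤ ∑ i, (m i + 1) := Finset.sum_le_sum (fun i _ => by
            by_cases h : (Sum.inr i : Y) ∈ S <;> simp [m, z0, h])
        _ = ∑ i, m i + Fintype.card I := by simp [Finset.sum_add_distrib]
        _ ≤ N := hcon
    obtain ⟨z, hz⟩ := hmk (fun i => z0 i + if i = i1 then N - ∑ i, z0 i else 0) (by
      rw [Finset.sum_add_distrib]
      simp only [Finset.sum_ite_eq', Finset.mem_univ, if_true]
      omega)
    obtain ⟨i, hi, hi2⟩ := hA z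
    obtain ⟨x, hx, hxk⟩ := hk2 i
    have h1 := hi2 x hx
    rw [hz, hxk] at h1
    simp only [z0, if_neg hi] at h1
    omega
  refine ⟨m, {x | ∃ w : X, (Sum.inl w : Y) ∈ S ∧ x = fun i => (w.1 i : ℕ)}, ?_, ?_, ?_⟩
  · obtain ⟨x, hx, -⟩ := hB i1 hi1
    exact ⟨_, x, hx, rfl⟩
  · rintro x ⟨w, hw, rfl⟩
    refine ⟨w.2, fun i => ⟨hm1 w hw i, ?_⟩⟩
    have h1 : ∑ j, ((w.1 j : ℕ) - m j) + ∑ j, m j = N := by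
      rw [← Finset.sum_add_distrib]
      exact (Finset.sum_congr rfl (fun j _ => Nat.sub_add_cancel (hm1 w hw j))).trans w.2
    have h2 := Finset.single_le_sum (f := fun j => (w.1 j : ℕ) - m j)
      (fun i _ => Nat.zero_le _) (Finset.mem_univ i)
    have h3 := hm1 w hw i
    have h4 : (w.1 i : ℕ) - m i ≤ ∑ j, ((w.1 j : ℕ) - m j) := h2
    show (w.1 i : ℕ) ≤ m i + Fintype.card I
    omega
  · intro i
    by_cases h : (Sum.inr i : Y) ∈ S
    · right; simp [m, h]
    · left
      obtain ⟨x, hx, hc⟩ := hB i h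
      exact ⟨_, ⟨x, hx, rfl⟩, hc⟩

lemma brouwer_approx (hI : 2 ≤ Fintype.card I) (f : (I → ℝ) → (I → ℝ))
    (hf : ∀ x ∈ stdSimplex ℝ I, f x ∈ stdSimplex ℝ I) (N : ℕ) :
    ∃ x ∈ stdSimplex ℝ I, ∀ i, ∃ y : I → ℝ,
      (∀ j, |y j - x j| ≤ (Fintype.card I : ℝ) / (N + 1)) ∧
      0 ≤ max (f y i - y i) ((Fintype.card I : ℝ) / (N + 1) - x i) := by
  have hN : (0 : ℝ) < N + 1 := by positivity
  let sc : (I → ℕ) → (I → ℝ) := fun x i => (x i : ℝ) / (N + 1)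
  have hsc : ∀ x : I → ℕ, ∑ i, x i = N + 1 → sc x ∈ stdSimplex ℝ I := by
    intro x hx
    refine ⟨fun i => by positivity, ?_⟩
    simp only [sc]
    rw [← Finset.sum_div, div_eq_one_iff_eq hN.ne']
    exact_mod_cast hx
  obtain ⟨k0⟩ : Nonempty I := Fintype.card_pos_iff.mp (by omega)
  have hcol : ∀ x : I → ℕ, ∃ i, ∑ i, x i = N + 1 → sc x i ≤ f (sc x) i := by
    intro x
    by_cases hx : ∑ i, x i = N + 1
    · by_contra hcon
      push Not at hcon
      have h1 := (hsc x hx).2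
      have h2 := (hf _ (hsc x hx)).2
      have := Finset.sum_lt_sum_of_nonempty (s := Finset.univ) ⟨k0, Finset.mem_univ _⟩
        (fun i _ => (hcon i).2)
      linarith
    · exact ⟨k0, fun h => absurd h hx⟩
  choose c hc using hcol
  obtain ⟨m, S, ⟨x, hx⟩, hS, hm⟩ := brouwer_grid hI (N + 1) c
  refine ⟨sc x, hsc x (hS x hx).1, fun i => ?_⟩
  rcases hm i with ⟨y, hy, hyi⟩ | h0
  · refine ⟨sc y, fun j => ?_, le_max_of_le_left ?_⟩
    · have h1 := (hS x hx).2 j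
      have h2 := (hS y hy).2 j
      simp only [sc]
      rw [← sub_div, abs_div, abs_of_pos hN]
      apply div_le_div_of_nonneg_right _ hN.le
      have a1 : (m j : ℝ) ≤ x j := by exact_mod_cast h1.1
      have a2 : (x j : ℝ) ≤ m j + Fintype.card I := by exact_mod_cast h1.2
      have a3 : (m j : ℝ) ≤ y j := by exact_mod_cast h2.1
      have a4 : (y j : ℝ) ≤ m j + Fintype.card I := by exact_mod_cast h2.2
      rw [abs_le]
      constructor <;> linarith
    · have := hc y (hS y hy).1
      rw [hyi] at this
      linarith
  · refine ⟨sc x, fun j => by simp; positivity, le_max_of_le_right ?_⟩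
    have h1 := ((hS x hx).2 i).2
    rw [h0, zero_add] at h1
    have : (x i : ℝ) ≤ Fintype.card I := by exact_mod_cast h1
    have := div_le_div_of_nonneg_right this hN.le
    simp only [sc]
    linarith

open Filter Topology in
theorem brouwer_simplex (hI : 2 ≤ Fintype.card I) (f : (I → ℝ) → (I → ℝ)) (hfc : Continuous f)
    (hf : ∀ x ∈ stdSimplex ℝ I, f x ∈ stdSimplex ℝ I) : ∃ x ∈ stdSimplex ℝ I, f x = x := by
  choose x hx y hy1 hy2 using brouwer_approx hI f hf
  obtain ⟨a, ha, φ, hφ, hlim⟩ := (isCompact_stdSimplex ℝ I).tendsto_subseq hx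
  have hk : Tendsto (fun n : ℕ => (Fintype.card I : ℝ) / (((φ n : ℕ) : ℝ) + 1)) atTop (𝓝 0) := by
    have h1 : Tendsto (fun n : ℕ => (Fintype.card I : ℝ) / ((n : ℝ) + 1)) atTop (𝓝 0) := by
      have := (tendsto_one_div_add_atTop_nhds_zero_nat (𝕜 := ℝ)).const_mul (Fintype.card I : ℝ)
      simpa [div_eq_mul_inv] using this
    exact h1.comp hφ.tendsto_atTop
  have hylim : ∀ i, Tendsto (fun n => y (φ n) i) atTop (𝓝 a) := by
    intro i
    rw [tendsto_pi_nhds]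
    intro j
    have hxj : Tendsto (fun n => x (φ n) j) atTop (𝓝 (a j)) := (tendsto_pi_nhds.mp hlim) j
    have hd : Tendsto (fun n => y (φ n) i j - x (φ n) j) atTop (𝓝 0) :=
      squeeze_zero_norm (fun n => by simpa using hy1 (φ n) i j) hk
    simpa using hd.add hxj
  have hle : ∀ i, a i ≤ f a i := by
    intro i
    have h1 : Tendsto (fun n => f (y (φ n) i) i) atTop (𝓝 (f a i)) :=
      (tendsto_pi_nhds.mp ((hfc.tendsto a).comp (hylim i))) i
    have h2 : Tendsto (fun n => y (φ n) i i) atTop (𝓝 (a i)) := (tendsto_pi_nhds.mp (hylim i)) i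
    have h3 : Tendsto (fun n => x (φ n) i) atTop (𝓝 (a i)) := (tendsto_pi_nhds.mp hlim) i
    have h4 := ge_of_tendsto' ((h1.sub h2).max (hk.sub h3)) (fun n => hy2 (φ n) i)
    rcases le_max_iff.mp h4 with h | h
    · linarith
    · have := (hf a ha).1 i
      linarith
  refine ⟨a, ha, ?_⟩
  have hs : ∑ i, (f a i - a i) = 0 := by
    rw [Finset.sum_sub_distrib, (hf a ha).2, ha.2, sub_self]
  funext i
  have := (Finset.sum_eq_zero_iff_of_nonneg (fun i _ => sub_nonneg.mpr (hle i))).mp hs i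
    (Finset.mem_univ i)
  linarith

end Brouwer

/-- Poincaré–Miranda on the cube `[-M, M]^d`. -/
theorem poincare_miranda {d : ℕ} (hd : 1 ≤ d) (M : ℝ) (hM : 0 < M)
    (f : (Fin d → ℝ) → (Fin d → ℝ)) (hfc : Continuous f)
    (h0 : ∀ x i, x i = -M → 0 ≤ f x i) (h1 : ∀ x i, x i = M → f x i ≤ 0) :
    ∃ x, f x = 0 := by
  have hd0 : (0 : ℝ) < d := by exact_mod_cast hd
  let cl : ℝ → ℝ := fun t => max 0 (min t (1 / d))
  have hclc : Continuous cl := by fun_prop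
  have hcl0 : ∀ t, 0 ≤ cl t := fun t => le_max_left _ _
  have hcl1 : ∀ t, cl t ≤ 1 / d := fun t => max_le (by positivity) (min_le_right _ _)
  -- point of the big cube
  let p : (Option (Fin d) → ℝ) → (Fin d → ℝ) := fun x i => 2 * M * d * x (some i) - M
  have hpc : Continuous p := by fun_prop
  let h : (Option (Fin d) → ℝ) → (Fin d → ℝ) := fun x i => cl (x (some i) + f (p x) i)
  have hhc : Continuous h := by
    apply continuous_pi
    intro i
    apply hclc.comp
    have : Continuous (fun x => f (p x) i) := (continuous_apply i).comp (hfc.comp hpc)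
    fun_prop
  let g : (Option (Fin d) → ℝ) → (Option (Fin d) → ℝ) :=
    fun x o => o.elim (1 - ∑ i, h x i) (fun i => h x i)
  have hgc : Continuous g := by
    apply continuous_pi
    rintro (_ | i)
    · exact continuous_const.sub (continuous_finsetSum _
        (fun i _ => (continuous_apply i).comp hhc))
    · exact (continuous_apply i).comp hhc
  obtain ⟨x, hx, hgx⟩ := brouwer_simplex (I := Option (Fin d)) (by simp; omega) g hgc (by
    intro x _
    constructor
    · rintro (_ | i)
      · have : ∑ i, h x i ≤ ∑ i : Fin d, (1 / d : ℝ) := Finset.sum_le_sum (fun i _ => hcl1 _)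
        simp only [Finset.sum_const, Finset.card_univ, Fintype.card_fin, nsmul_eq_mul] at this
        rw [mul_one_div_cancel hd0.ne'] at this
        simp only [g, Option.elim]
        linarith
      · exact hcl0 _
    · simp [g, Fintype.sum_option])
  refine ⟨p x, ?_⟩
  funext i
  have hi : cl (x (some i) + f (p x) i) = x (some i) := congrFun hgx (some i)
  have b0 := hcl0 (x (some i) + f (p x) i)
  have b1 := hcl1 (x (some i) + f (p x) i)
  rw [hi] at b0 b1
  show f (p x) i = 0
  rcases lt_trichotomy (f (p x) i) 0 with hneg | hz | hpos
  · exfalso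
    have hx0 : x (some i) = 0 := by
      by_contra hne
      have hxp : 0 < x (some i) := lt_of_le_of_ne b0 (Ne.symm hne)
      have : cl (x (some i) + f (p x) i) < x (some i) := by
        apply max_lt hxp
        exact (min_le_left _ _).trans_lt (by linarith)
      linarith
    have := h0 (p x) i (by simp [p, hx0])
    linarith
  · exact hz
  · exfalso
    have hx1 : x (some i) = 1 / d := by
      by_contra hne
      have hxp : x (some i) < 1 / d := lt_of_le_of_ne b1 hne
      have : x (some i) < cl (x (some i) + f (p x) i) := by
        apply lt_max_of_lt_right
        exact lt_min (by linarith) hxp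
      linarith
    have := h1 (p x) i (by
      simp only [p, hx1]
      field_simp
      ring)
    linarith

section Greedy

variable {ι J : Type*} [Fintype ι]

open Classical in
lemma greedy_step (W : ι → ℝ) (hW : ∀ k, 0 ≤ W k) (τ : ι → J → ℝ)
    (hτ : ∀ k i, τ k i = 0 ∨ τ k i = 1 ∨ τ k i = -1) (hbal : ∀ i, ∑ k, W k * τ k i = 0)
    (k0 : ι) (hk0 : 0 < W k0) (R : Finset J) (hR : R.Nonempty)
    (hR0 : ∀ i ∈ R, τ k0 i ≠ 0) :
    ∃ k, 0 < W k ∧ 2 * (R.filter (fun i => τ k i = τ k0 i)).card < R.card := by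
  by_contra hcon
  push Not at hcon
  let q : ι → J → ℝ := fun k i => if τ k i = τ k0 i then 1 else -1
  have hq : ∀ k, 0 < W k → 0 ≤ ∑ i ∈ R, q k i := by
    intro k hk
    have h1 := hcon k hk
    have h2 : ∑ i ∈ R, q k i = 2 * ((R.filter (fun i => τ k i = τ k0 i)).card : ℝ) - R.card := by
      have : ∀ i, q k i = 2 * (if τ k i = τ k0 i then 1 else 0) - 1 := by
        intro i
        simp only [q]
        split_ifs <;> norm_num
      simp only [this, Finset.sum_sub_distrib, ← Finset.mul_sum, Finset.sum_boole]
      simp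
    have h3 : (R.card : ℝ) ≤ 2 * ((R.filter (fun i => τ k i = τ k0 i)).card : ℝ) := by
      exact_mod_cast h1
    linarith
  have hpos : 0 < ∑ k, W k * ∑ i ∈ R, q k i := by
    apply Finset.sum_pos'
    · intro k _
      rcases (hW k).eq_or_lt with h | h
      · rw [← h, zero_mul]
      · exact mul_nonneg h.le (hq k h)
    · refine ⟨k0, Finset.mem_univ _, mul_pos hk0 ?_⟩
      simp [q, hR]
  have hle : ∑ k, W k * ∑ i ∈ R, q k i ≤ ∑ k, W k * ∑ i ∈ R, τ k i * τ k0 i := by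
    apply Finset.sum_le_sum
    intro k _
    apply mul_le_mul_of_nonneg_left _ (hW k)
    apply Finset.sum_le_sum
    intro i hi
    have h0 := hR0 i hi
    simp only [q]
    rcases hτ k i with h | h | h <;> rcases hτ k0 i with h' | h' | h' <;>
      first
      | exact absurd h' h0
      | (rw [h, h']; norm_num)
  have hz : ∑ k, W k * ∑ i ∈ R, τ k i * τ k0 i = 0 := by
    simp only [Finset.mul_sum]
    rw [Finset.sum_comm]
    apply Finset.sum_eq_zero
    intro i _
    have : ∑ k, W k * (τ k i * τ k0 i) = (∑ k, W k * τ k i) * τ k0 i := by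
      rw [Finset.sum_mul]
      exact Finset.sum_congr rfl (fun k _ => by ring)
    rw [this, hbal, zero_mul]
  linarith

open Classical in
lemma greedy (W : ι → ℝ) (hW : ∀ k, 0 ≤ W k) (τ : ι → J → ℝ)
    (hτ : ∀ k i, τ k i = 0 ∨ τ k i = 1 ∨ τ k i = -1) (hbal : ∀ i, ∑ k, W k * τ k i = 0)
    (k0 : ι) (hk0 : 0 < W k0) (n : ℕ) : ∀ (R : Finset J)
    (_ : ∀ i ∈ R, τ k0 i ≠ 0) (_ : R.card + 2 ≤ 2 ^ (n + 1)),
    ∃ P : Finset ι, P.card ≤ n ∧ (∀ k ∈ P, 0 < W k) ∧ ∀ i ∈ R, ∃ k ∈ P, τ k i ≠ τ k0 i := by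
  induction n with
  | zero =>
    intro R _ hc
    have : R = ∅ := by
      rw [← Finset.card_eq_zero]
      simp at hc
      simp [hc]
    subst this
    exact ⟨∅, by simp, by simp, by simp⟩
  | succ n ih =>
    intro R hR0 hc
    rcases R.eq_empty_or_nonempty with rfl | hR
    · exact ⟨∅, by simp, by simp, by simp⟩
    obtain ⟨k, hk, hlt⟩ := greedy_step W hW τ hτ hbal k0 hk0 R hR hR0
    obtain ⟨P, hP1, hP2, hP3⟩ := ih (R.filter (fun i => τ k i = τ k0 i))
      (fun i hi => hR0 i (Finset.mem_filter.mp hi).1) (by rw [pow_succ] at hc; omega)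
    refine ⟨insert k P, (Finset.card_insert_le _ _).trans (by omega), ?_, ?_⟩
    · intro k' hk'
      rcases Finset.mem_insert.mp hk' with rfl | h
      · exact hk
      · exact hP2 _ h
    · intro i hi
      by_cases h : τ k i = τ k0 i
      · obtain ⟨k', hk', h'⟩ := hP3 i (Finset.mem_filter.mpr ⟨hi, h⟩)
        exact ⟨k', Finset.mem_insert_of_mem hk', h'⟩
      · exact ⟨k, Finset.mem_insert_self _ _, h⟩

end Greedy

lemma slice_weights (A : Set ℝ) (hA : (∃ a b : ℝ, a ≤ b ∧ A = Set.Icc a b) ∨ A = ∅) :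
    ∃ (wt sg : ℝ → ℝ) (M : ℝ), Continuous wt ∧ Continuous sg ∧ (∀ x, 0 ≤ wt x) ∧
      (∀ x, wt x = 0 → x ∈ A) ∧ (∀ x, ∃ t : ℝ, sg x = t * wt x ∧
        (wt x ≠ 0 → (t = 0 ∧ A = ∅ ∨ t = 1 ∧ (∀ y ∈ A, x < y) ∨ t = -1 ∧ ∀ y ∈ A, y < x))
        ∧ (t = 0 ∨ t = 1 ∨ t = -1)) ∧
      (∀ x, M ≤ x → sg x ≤ 0) ∧ (∀ x, x ≤ -M → 0 ≤ sg x) := by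
  rcases hA with ⟨a, b, hab, rfl⟩ | rfl
  · refine ⟨fun x => max (a - x) 0 + max (x - b) 0, fun x => max (a - x) 0 - max (x - b) 0,
      max |a| |b|, by fun_prop, by fun_prop, fun x => by positivity, ?_, ?_, ?_, ?_⟩
    · intro x hx
      have h1 := le_max_right (a - x) 0
      have h2 := le_max_right (x - b) 0
      have h3 := le_max_left (a - x) 0
      have h4 := le_max_left (x - b) 0
      constructor <;> linarith
    · intro x
      rcases lt_or_ge x a with h | h
      · refine ⟨1, ?_, fun _ => Or.inr (Or.inl ⟨rfl, fun y hy => h.trans_le hy.1⟩), by simp⟩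
        beta_reduce
        rw [max_eq_right (by linarith : x - b ≤ 0)]; ring
      · rcases lt_or_ge b x with h' | h'
        · refine ⟨-1, ?_, fun _ => Or.inr (Or.inr ⟨rfl, fun y hy => hy.2.trans_lt h'⟩), by simp⟩
          beta_reduce
          rw [max_eq_right (by linarith : a - x ≤ 0)]; ring
        · have e1 := max_eq_right (by linarith : a - x ≤ 0)
          have e2 := max_eq_right (by linarith : x - b ≤ 0)
          refine ⟨0, ?_, fun hne => ?_, by simp⟩
          · beta_reduce
            rw [e1, e2]; ring
          · beta_reduce at hne
            rw [e1, e2] at hne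
            exact absurd (by ring) hne
    · intro x hx
      have h1 : a ≤ x := (le_abs_self a).trans ((le_max_left _ _).trans hx)
      beta_reduce
      rw [max_eq_right (by linarith : a - x ≤ 0)]
      have h2 := le_max_right (x - b) 0
      linarith
    · intro x hx
      have h1 : |b| ≤ max |a| |b| := le_max_right _ _
      have h2 := neg_abs_le b
      beta_reduce
      rw [max_eq_right (by linarith : x - b ≤ 0)]
      have h2 := le_max_right (a - x) 0
      linarith
  · exact ⟨fun _ => 1, fun _ => 0, 0, by fun_prop, by fun_prop, fun x => by norm_num,
      fun x h => absurd h one_ne_zero,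
      fun x => ⟨0, by simp, fun _ => Or.inl ⟨rfl, rfl⟩, by simp⟩, by simp, by simp⟩

/-- Kaiser–Rabinovich: a finite family of separated `d`-intervals in which every
`⌈log₂(d+2)⌉` members have a common point can be pierced by at most `d` points. -/
theorem kaiser_rabinovich {d : ℕ} (hd : 1 ≤ d) {ι : Type*} [Fintype ι]
    (F : ι → Set (Fin d × ℝ)) (hF : ∀ i, IsSeparatedDInterval d (F i))
    (hagree : ∀ P : Finset ι, P.card = Nat.clog 2 (d + 2) →
      (⋂ i ∈ P, F i).Nonempty) :
    ∃ C : Finset (Fin d × ℝ), C.card ≤ d ∧ ∀ i, ∃ x ∈ C, x ∈ F i := by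
  classical
  have hclog : Nat.clog 2 (d + 2) ≤ d + 1 := by
    apply Nat.clog_le_of_le_pow
    have : d + 1 < 2 ^ (d + 1) := Nat.lt_two_pow_self
    omega
  rcases lt_or_ge (Fintype.card ι) (Nat.clog 2 (d + 2)) with hsmall | hbig
  · choose z hz using fun i => (hF i).1
    refine ⟨Finset.univ.image z, Finset.card_image_le.trans ?_, fun i => ⟨z i, by simp, hz i⟩⟩
    rw [Finset.card_univ]
    omega
  choose wt sg M hwc hsc hw0 hwA hsg hM1 hM2 using
    fun (k : ι) (i : Fin d) => slice_weights _ ((hF k).2 i)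
  let B : ℝ := 1 + ∑ k, ∑ i, |M k i|
  have hB : ∀ k i, M k i ≤ B := by
    intro k i
    have h1 := Finset.single_le_sum (f := fun i => |M k i|) (fun i _ => abs_nonneg _)
      (Finset.mem_univ i)
    have h2 := Finset.single_le_sum (f := fun k => ∑ i, |M k i|)
      (fun k _ => Finset.sum_nonneg (fun i _ => abs_nonneg _)) (Finset.mem_univ k)
    have h3 := le_abs_self (M k i)
    simp only [B]
    linarith
  have hBpos : 0 < B := by
    have : 0 ≤ ∑ k, ∑ i, |M k i| :=
      Finset.sum_nonneg (fun k _ => Finset.sum_nonneg (fun i _ => abs_nonneg _))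
    simp only [B]
    linarith
  let rest : ι → Fin d → (Fin d → ℝ) → ℝ := fun k i x => ∏ j ∈ Finset.univ.erase i, wt k j (x j)
  have hrest : ∀ k i x, 0 ≤ rest k i x := fun k i x => Finset.prod_nonneg (fun j _ => hw0 k j _)
  obtain ⟨x, hx⟩ := poincare_miranda hd B hBpos
    (fun x i => ∑ k, sg k i (x i) * rest k i x)
    (by
      apply continuous_pi
      intro i
      apply continuous_finsetSum
      intro k _
      apply ((hsc k i).comp (continuous_apply i)).mul
      apply continuous_finsetProd
      intro j _
      exact (hwc k j).comp (continuous_apply j))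
    (fun x i hxi => Finset.sum_nonneg (fun k _ =>
      mul_nonneg (hM2 k i _ (by rw [hxi]; linarith [hB k i])) (hrest k i x)))
    (fun x i hxi => Finset.sum_nonpos (fun k _ =>
      mul_nonpos_of_nonpos_of_nonneg (hM1 k i _ (by rw [hxi]; exact hB k i)) (hrest k i x)))
  by_contra hcon
  push Not at hcon
  obtain ⟨k0, hk0⟩ := hcon (Finset.univ.image (fun i => (i, x i)))
    (Finset.card_image_le.trans (by simp))
  let W : ι → ℝ := fun k => ∏ j, wt k j (x j)
  have hW : ∀ k, 0 ≤ W k := fun k => Finset.prod_nonneg (fun j _ => hw0 k j _)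
  have hWpos : 0 < W k0 := by
    apply Finset.prod_pos
    intro j _
    refine lt_of_le_of_ne (hw0 k0 j _) (fun h => ?_)
    exact hk0 (j, x j) (by simp) (hwA k0 j (x j) h.symm)
  have hne : ∀ k, 0 < W k → ∀ i, wt k i (x i) ≠ 0 := by
    intro k hk i h
    have : W k = 0 := Finset.prod_eq_zero (Finset.mem_univ i) h
    linarith
  choose τ hτ1 hτ2 hτ3 using fun k i => hsg k i (x i)
  have hbal : ∀ i, ∑ k, W k * τ k i = 0 := by
    intro i
    have h := congrFun hx i
    simp only [Pi.zero_apply] at h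
    rw [← h]
    apply Finset.sum_congr rfl
    intro k _
    have : W k = wt k i (x i) * rest k i x :=
      (Finset.mul_prod_erase Finset.univ (fun j => wt k j (x j)) (Finset.mem_univ i)).symm
    rw [this, hτ1]
    ring
  obtain ⟨n, hn⟩ : ∃ n, Nat.clog 2 (d + 2) = n + 1 :=
    Nat.exists_eq_succ_of_ne_zero (Nat.clog_pos (by norm_num) (by omega)).ne'
  have hpow : d + 2 ≤ 2 ^ (n + 1) := by
    rw [← hn]
    exact Nat.le_pow_clog (by norm_num) _
  obtain ⟨P, hP1, hP2, hP3⟩ := greedy W hW τ hτ3 hbal k0 hWpos n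
    (Finset.univ.filter (fun i => τ k0 i ≠ 0)) (by simp)
    (by
      have := Finset.card_filter_le (Finset.univ : Finset (Fin d)) (fun i => τ k0 i ≠ 0)
      simp only [Finset.card_univ, Fintype.card_fin] at this
      omega)
  obtain ⟨Q, hQ1, -, hQ2⟩ := Finset.exists_subsuperset_card_eq (Finset.subset_univ (insert k0 P))
    (n := Nat.clog 2 (d + 2)) ((Finset.card_insert_le _ _).trans (by omega))
    (by rw [Finset.card_univ]; exact hbig)
  obtain ⟨⟨i, y⟩, hy⟩ := hagree Q hQ2
  simp only [Set.mem_iInter] at hy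
  have hy0 : y ∈ {y : ℝ | (i, y) ∈ F k0} := hy k0 (hQ1 (Finset.mem_insert_self _ _))
  have hnz : ∀ k, 0 < W k → y ∈ {y : ℝ | (i, y) ∈ F k} →
      (τ k i = 1 ∧ x i < y ∨ τ k i = -1 ∧ y < x i) := by
    intro k hk hyk
    rcases hτ2 k i (hne k hk i) with ⟨_, h⟩ | ⟨h1, h⟩ | ⟨h1, h⟩
    · rw [h] at hyk
      exact absurd hyk (Set.notMem_empty _)
    · exact Or.inl ⟨h1, h y hyk⟩
    · exact Or.inr ⟨h1, h y hyk⟩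
  have hk0s := hnz k0 hWpos hy0
  obtain ⟨k, hkP, hkne⟩ := hP3 i (by
    simp only [Finset.mem_filter, Finset.mem_univ, true_and]
    rcases hk0s with h | h <;> rw [h.1] <;> norm_num)
  have hks := hnz k (hP2 k hkP) (hy k (hQ1 (Finset.mem_insert_of_mem hkP)))
  rcases hk0s with ⟨h1, h2⟩ | ⟨h1, h2⟩ <;> rcases hks with ⟨h3, h4⟩ | ⟨h3, h4⟩
  · exact hkne (h3.trans h1.symm)
  · exact lt_asymm h2 h4
  · exact lt_asymm h2 h4
  · exact hkne (h3.trans h1.symm)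
end

section
/- Let G be a finite tree (a finite connected acyclic simple graph), let d ≥ 1 and p ≥ 2 be integers, and let F be a finite family of nonempty vertex subsets of G, each of which induces a subgraph of G with at most d connected components. Suppose F satisfies the (p,2)-property: among every p members of F there exist 2 with a common vertex. Then there exists a set of at most 2(p-1)d² vertices of G that intersects every member of F. -/
open Finset in
theorem wturan {ι : Type*} [DecidableEq ι] (R : ι → ι → Prop) [DecidableRel R] (hr : ∀ i, R i i)
    (hs : ∀ i j, R i j → R j i) (x : ι → ℝ) (hx : ∀ i, 0 ≤ x i) (α : ℕ) : ∀ (S : Finset ι),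
    (∀ P ⊆ S, P.card = α + 1 → ∃ i ∈ P, ∃ j ∈ P, i ≠ j ∧ R i j) →
    (∑ i ∈ S, x i) ^ 2 ≤ α * ∑ i ∈ S, x i * ∑ j ∈ S with R i j, x j := by
  induction α with
  | zero =>
    intro S h
    have : S = ∅ := by
      by_contra hne
      obtain ⟨i, hi⟩ := Finset.nonempty_iff_ne_empty.2 hne
      obtain ⟨a, ha, b, hb, hab, _⟩ := h {i} (by simpa using hi) (by simp)
      simp_all
    simp [this]
  | succ k ih =>
    intro S h
    rcases S.eq_empty_or_nonempty with rfl | hne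
    · simp
    obtain ⟨i, hi, hmin⟩ := S.exists_min_image (fun i => ∑ j ∈ S with R i j, x j) hne
    set δ := ∑ j ∈ S with R i j, x j with hδ
    have hδ0 : 0 ≤ δ := Finset.sum_nonneg fun j _ => hx j
    set S' := S.filter (fun j => ¬ R i j) with hS'
    have h1 := ih S' (by
      intro P hP hc
      have hiP : i ∉ P := fun hh => by
        have := hP hh
        simp [hS', hr] at this
      obtain ⟨a, ha, b, hb, hab, hR⟩ := h (insert i P) (by
        intro y hy
        rcases Finset.mem_insert.1 hy with rfl | hy
        · exact hi
        · exact (Finset.mem_filter.1 (hP hy)).1) (by rw [Finset.card_insert_of_notMem hiP, hc])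
      rcases Finset.mem_insert.1 ha with rfl | ha'
      · rcases Finset.mem_insert.1 hb with rfl | hb
        · exact absurd rfl hab
        · exact absurd hR (Finset.mem_filter.1 (hP hb)).2
      · rcases Finset.mem_insert.1 hb with rfl | hb
        · exact absurd (hs _ _ hR) (Finset.mem_filter.1 (hP ha')).2
        · exact ⟨a, ha', b, hb, hab, hR⟩)
    set W := ∑ j ∈ S', x j with hW
    have hsum : ∑ j ∈ S, x j = δ + W := (Finset.sum_filter_add_sum_filter_not S _ _).symm
    set E' := ∑ i ∈ S', x i * ∑ j ∈ S' with R i j, x j with hE'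
    have hE : δ * δ + E' ≤ ∑ i ∈ S, x i * ∑ j ∈ S with R i j, x j := by
      rw [← Finset.sum_filter_add_sum_filter_not S (fun j => R i j)]
      apply add_le_add
      · nth_rewrite 1 [hδ]
        rw [Finset.sum_mul]
        apply Finset.sum_le_sum
        intro j hj
        exact mul_le_mul_of_nonneg_left (hmin j (Finset.mem_filter.1 hj).1) (hx j)
      · apply Finset.sum_le_sum
        intro j hj
        apply mul_le_mul_of_nonneg_left _ (hx j)
        apply Finset.sum_le_sum_of_subset_of_nonneg
        · exact Finset.filter_subset_filter _ (Finset.filter_subset _ _)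
        · intros; exact hx _
    have hW0 : 0 ≤ W := Finset.sum_nonneg fun j _ => hx j
    have hE0 : 0 ≤ E' := Finset.sum_nonneg fun j _ =>
      mul_nonneg (hx j) (Finset.sum_nonneg fun j _ => hx j)
    rw [hsum]
    push_cast
    refine le_trans ?_ (mul_le_mul_of_nonneg_left hE (by positivity))
    have hk : (0:ℝ) ≤ k := by positivity
    rcases hk.eq_or_lt with hk | hk
    · rw [← hk] at h1 ⊢
      have : W = 0 := by nlinarith
      rw [this]; nlinarith
    · have : 2 * δ * W ≤ k * δ ^ 2 + E' := by
        refine le_of_mul_le_mul_left ?_ hk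
        nlinarith [sq_nonneg (k * δ - W)]
      nlinarith

theorem lpd {V ι : Type*} [Fintype V] [Nonempty V] [Fintype ι] (F : ι → Set V) 
    [∀ i v, Decidable (v ∈ F i)] (c : ℝ)
    (h : ∀ x : ι → ℝ, (∀ i, 0 ≤ x i) → ∀ m : ℝ, (∀ v, ∑ i with v ∈ F i, x i ≤ m) →
      c * ∑ i, x i ≤ m) :
    ∃ w : V → ℝ, (∀ v, 0 ≤ w v) ∧ ∑ v, w v = 1 ∧ ∀ i, c ≤ ∑ v with v ∈ F i, w v := by
  classical
  by_contra hcon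
  push Not at hcon
  let L : (V → ℝ) →ₗ[ℝ] (ι → ℝ) :=
    LinearMap.pi fun i => ∑ v with v ∈ F i, LinearMap.proj v
  have hL : ∀ w i, L w i = ∑ v with v ∈ F i, w v := by intro w i; simp [L]
  let A := L '' stdSimplex ℝ V
  let B : Set (ι → ℝ) := Set.Ici (fun _ => c)
  have hAB : Disjoint A B := by
    rw [Set.disjoint_left]
    rintro _ ⟨w, hw, rfl⟩ hB
    obtain ⟨i, hi⟩ := hcon w hw.1 hw.2
    have := hB i
    rw [hL] at this
    simp only at this
    linarith
  have hAc : IsCompact A := (isCompact_stdSimplex ℝ V).image L.continuous_of_finiteDimensional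
  obtain ⟨f, u, v, hfu, huv, hfv⟩ := geometric_hahn_banach_compact_closed
    ((convex_stdSimplex ℝ V).linear_image L) hAc (convex_Ici _) isClosed_Ici hAB
  let x : ι → ℝ := fun i => f (Pi.single i 1)
  have hf : ∀ y : ι → ℝ, f y = ∑ i, y i * x i := by
    intro y
    conv_lhs => rw [← Finset.univ_sum_single y]
    rw [map_sum]
    refine Finset.sum_congr rfl fun i _ => ?_
    have : (Pi.single i (y i) : ι → ℝ) = y i • Pi.single i 1 := by
      rw [← Pi.single_smul]; simp
    rw [this, map_smul]; rfl
  have hc := hfv (fun _ => c) (by simp [B])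
  have hx : ∀ i, 0 ≤ x i := by
    intro i
    by_contra hneg
    push Not at hneg
    have h1 := hfv ((fun _ => c) + ((f (fun _ => c) - v) / (- x i)) • Pi.single i 1) (by
      simp only [B, Set.mem_Ici]
      apply le_add_of_nonneg_right
      apply smul_nonneg
      · apply div_nonneg <;> linarith
      · exact Pi.single_nonneg.2 zero_le_one)
    rw [map_add, map_smul] at h1
    change _ < _ + _ * x i at h1
    have : (f (fun _ => c) - v) / (- x i) * x i = - (f (fun _ => c) - v) := by
      have hxi : x i ≠ 0 := hneg.ne
      field_simp
    linarith
  have := h x hx u (by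
    intro v0
    have h1 := hfu (L (Pi.single v0 1)) ⟨_, single_mem_stdSimplex ℝ v0, rfl⟩
    rw [hf] at h1
    refine le_trans (le_of_eq ?_) h1.le
    rw [Finset.sum_filter]
    refine Finset.sum_congr rfl fun i _ => ?_
    rw [hL]
    simp [Finset.sum_filter, Pi.single_apply])
  rw [hf, ← Finset.mul_sum] at hc
  linarith

def TCon {V : Type*} (G : SimpleGraph V) (T : Set V) : Prop :=
  T.Nonempty ∧ ∀ D : Set V, (∀ a ∈ D, a ∈ T → ∀ b ∈ T, G.Adj a b → b ∈ D) →
    ∀ a ∈ D, a ∈ T → ∀ b ∈ T, b ∈ D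

theorem greedy_s17 {V ι : Type*} [DecidableEq V] [DecidableEq ι] (C : Set V → Prop) (top : Set V → V) (dep : V → ℕ)
    (h1 : ∀ T, C T → top T ∈ T)
    (h2 : ∀ T T', C T → C T' → (T ∩ T').Nonempty → dep (top T') ≤ dep (top T) → top T ∈ T')
    (T : ι → Set V) (hT : ∀ i, C (T i)) (S : Finset ι) :
    ∃ X : Finset V, ∃ J ⊆ S, X.card ≤ J.card ∧ (∀ i ∈ J, ∀ j ∈ J, i ≠ j → Disjoint (T i) (T j)) ∧
      ∀ i ∈ S, ∃ v ∈ X, v ∈ T i := by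
  classical
  induction S using Finset.strongInduction with
  | H S ih =>
    rcases S.eq_empty_or_nonempty with rfl | hne
    · exact ⟨∅, ∅, by simp⟩
    obtain ⟨i, hi, hmax⟩ := S.exists_max_image (fun i => dep (top (T i))) hne
    obtain ⟨X, J, hJ, hc, hd, hp⟩ := ih (S.filter fun j => top (T i) ∉ T j)
      (Finset.filter_ssubset.2 ⟨i, hi, by simpa using h1 _ (hT i)⟩)
    have hdis : ∀ j ∈ J, Disjoint (T i) (T j) := by
      intro j hj
      have := Finset.mem_filter.1 (hJ hj)
      by_contra hh
      exact this.2 (h2 _ _ (hT i) (hT j) (Set.not_disjoint_iff_nonempty_inter.1 hh) (hmax j this.1))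
    have hiJ : i ∉ J := fun hh => (Finset.mem_filter.1 (hJ hh)).2 (h1 _ (hT i))
    refine ⟨insert (top (T i)) X, insert i J, ?_, ?_, ?_, ?_⟩
    · exact Finset.insert_subset hi (hJ.trans (Finset.filter_subset _ _))
    · rw [Finset.card_insert_of_notMem hiJ]
      exact (Finset.card_insert_le _ _).trans (by omega)
    · intro a ha b hb hab
      rcases Finset.mem_insert.1 ha with rfl | ha' <;> rcases Finset.mem_insert.1 hb with rfl | hb
      · exact absurd rfl hab
      · exact hdis _ hb
      · exact (hdis _ ha').symm
      · exact hd _ ha' _ hb hab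
    · intro j hj
      by_cases hh : top (T i) ∈ T j
      · exact ⟨_, Finset.mem_insert_self _ _, hh⟩
      · obtain ⟨v, hv, hv'⟩ := hp j (Finset.mem_filter.2 ⟨hj, hh⟩)
        exact ⟨v, Finset.mem_insert_of_mem hv, hv'⟩

theorem par_unique {V : Type*} (G : SimpleGraph V) (hc : G.Connected) (ha : G.IsAcyclic) (r x a b : V)
    (hxa : G.Adj x a) (hxb : G.Adj x b) (h1 : G.dist a r < G.dist x r) (h2 : G.dist b r < G.dist x r) :
    a = b := by
  classical
  have key : ∀ y, G.Adj x y → G.dist y r < G.dist x r → ∃ p : G.Path x r, p.1.snd = y := by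
    intro y hxy hy
    obtain ⟨p, hp, hl⟩ := hc.exists_path_of_dist y r
    refine ⟨⟨SimpleGraph.Walk.cons hxy p, hp.cons ?_⟩, by simp⟩
    intro hx
    have h3 := G.dist_le (p.dropUntil x hx)
    have h4 := p.length_dropUntil_le hx
    omega
  obtain ⟨p, rfl⟩ := key a hxa h1
  obtain ⟨q, rfl⟩ := key b hxb h2
  rw [ha.path_unique p q]

theorem tops {V : Type*} (G : SimpleGraph V) (hc : G.Connected) (ha : G.IsAcyclic) :
    ∃ (top : Set V → V) (dep : V → ℕ), (∀ T, TCon G T → top T ∈ T) ∧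
    (∀ T T', TCon G T → TCon G T' → (T ∩ T').Nonempty → dep (top T') ≤ dep (top T) → top T ∈ T') := by
  classical
  obtain ⟨r⟩ := hc.nonempty
  let dep : V → ℕ := fun v => G.dist v r
  have hpar : ∀ v, ∃ u, v ≠ r → G.Adj v u ∧ dep u < dep v := by
    intro v
    by_cases hv : v = r
    · exact ⟨v, fun h => absurd hv h⟩
    obtain ⟨p, hp, hl⟩ := hc.exists_path_of_dist v r
    cases p with
    | nil => exact absurd rfl hv
    | cons h p =>
      refine ⟨_, fun _ => ⟨h, ?_⟩⟩
      have := G.dist_le p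
      simp only [SimpleGraph.Walk.length_cons] at hl
      simp only [dep]; omega
  choose par hpar using hpar
  have hedge : ∀ a b, G.Adj a b → dep b < dep a → b = par a := by
    intro a b hab hlt
    have har : a ≠ r := by rintro rfl; simp [dep] at hlt
    exact par_unique G hc ha r a b (par a) hab (hpar a har).1 hlt (hpar a har).2
  have hedge2 : ∀ a b, G.Adj a b → b = par a ∨ a = par b := by
    intro a b hab
    have := ha.dist_ne_of_adj (u := r) hab (hc r a)
    rw [G.dist_comm, G.dist_comm (u := r)] at this
    rcases lt_or_gt_of_ne this with h | h
    · exact Or.inr (hedge b a hab.symm h)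
    · exact Or.inl (hedge a b hab h)
  have htop : ∀ T : Set V, ∃ t, T.Nonempty → t ∈ T ∧ ∀ s ∈ T, dep t ≤ dep s := by
    intro T
    by_cases hT : T.Nonempty
    · obtain ⟨t, ht, hm⟩ := exists_minimalFor_of_wellFoundedLT (· ∈ T) dep hT
      refine ⟨t, fun _ => ⟨ht, fun s hs => ?_⟩⟩
      by_contra hh
      push Not at hh
      exact absurd (hm hs hh.le) (by simpa using hh)
    · exact ⟨r, fun h => absurd h hT⟩
  choose top htop using htop
  -- moving up stays in T
  have hup : ∀ T, TCon G T → ∀ v ∈ T, v ≠ top T → v ≠ r ∧ par v ∈ T := by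
    intro T hT v hv hne
    obtain ⟨ht, hmin⟩ := htop T hT.1
    have hvr : v ≠ r := by
      rintro rfl
      have h0 := hmin v hv
      have : dep (top T) = 0 := by
        have : dep v = 0 := by simp [dep]
        omega
      exact hne (hc.dist_eq_zero_iff.1 this).symm
    refine ⟨hvr, ?_⟩
    by_contra hpv
    -- inductive set: points whose parent chain inside non-roots reaches v
    let D : Set V := {y | Relation.ReflTransGen (fun a b => a ≠ r ∧ b = par a) y v}
    have hD : ∀ y ∈ D, y = v ∨ dep v < dep y := by
      intro y hy
      induction hy using Relation.ReflTransGen.head_induction_on with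
      | refl => exact Or.inl rfl
      | head h _ ih =>
        obtain ⟨h1, rfl⟩ := h
        have := (hpar _ h1).2
        rcases ih with ih | ih
        · rw [ih] at this; exact Or.inr this
        · exact Or.inr (ih.trans this)
    have hmem := hT.2 D (by
      intro a haD haT b hbT hab
      have haux : ∀ x y, G.Adj x y → y = par x → dep x < dep y → x = r := by
        intro x y _ hy hlt
        by_contra hx
        have := (hpar x hx).2
        rw [← hy] at this; omega
      by_cases hlt : dep b < dep a
      · have hb := hedge a b hab hlt
        rcases Relation.ReflTransGen.cases_head haD with rfl | ⟨c, ⟨_, rfl⟩, hc'⟩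
        · rw [hb] at hbT; exact absurd hbT hpv
        · rw [hb]; exact hc'
      · have hlt' : dep a < dep b := by
          have := ha.dist_ne_of_adj (u := r) hab (hc r a)
          rw [G.dist_comm, G.dist_comm (u := r)] at this
          simp only [dep] at hlt ⊢
          omega
        have hb := hedge b a hab.symm hlt'
        have hbr : b ≠ r := by rintro rfl; simp [dep] at hlt'
        exact Relation.ReflTransGen.head ⟨hbr, hb⟩ haD) v Relation.ReflTransGen.refl hv (top T) ht
    rcases hD _ hmem with h | h
    · exact hne h.symm
    · have := hmin v hv; omega
  refine ⟨top, dep, fun T hT => (htop T hT.1).1, ?_⟩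
  rintro T T' hT hT' ⟨v, hv, hv'⟩ hle
  obtain ⟨n, hn⟩ : ∃ n, dep v = n := ⟨_, rfl⟩
  induction n using Nat.strong_induction_on generalizing v with
  | _ n ih =>
    by_cases h1 : v = top T
    · rw [← h1]; exact hv'
    obtain ⟨hr, hp⟩ := hup T hT v hv h1
    have hlt := (hpar v hr).2
    by_cases h2 : v = top T'
    · have := (htop T hT.1).2 _ hp
      rw [← h2] at hle; omega
    · exact ih (dep (par v)) (by omega) (par v) hp (hup T' hT' v hv' h2).2 rfl

theorem comp_con {V : Type*} (G : SimpleGraph V) (S : Set V) (K : (G.induce S).ConnectedComponent) :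
    TCon G (Subtype.val '' K.supp) := by
  refine ⟨K.nonempty_supp.image _, ?_⟩
  rintro D hD _ haD ⟨a, ha, rfl⟩ _ ⟨b, hb, rfl⟩
  have hab : (G.induce S).Reachable a b :=
    SimpleGraph.ConnectedComponent.exact (Eq.trans ha (Eq.symm hb))
  obtain ⟨w⟩ := hab
  induction w with
  | nil => exact haD
  | @cons u v w h p ih =>
    have hv : v ∈ K.supp := (K.mem_supp_congr_adj h).1 ha
    exact ih hv (hD _ haD ⟨u, ha, rfl⟩ _ ⟨v, hv, rfl⟩ h) hb

/-- Alon's theorem: in a finite tree `G`, a finite family of nonempty vertex subsets,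
each inducing a subgraph with at most `d` connected components, satisfying the
`(p,2)`-property can be pierced by at most `2(p-1)d²` vertices. -/
theorem alon_d_trees {V : Type*} [Fintype V] (G : SimpleGraph V)
    (htree : G.Connected ∧ G.IsAcyclic)
    {d p : ℕ} (hd : 1 ≤ d) (hp : 2 ≤ p) {ι : Type*} [Fintype ι]
    (F : ι → Set V) (hne : ∀ i, (F i).Nonempty)
    (hcomp : ∀ i, Nat.card (G.induce (F i)).ConnectedComponent ≤ d)
    (hp2 : ∀ P : Finset ι, P.card = p →
      ∃ Q ⊆ P, Q.card = 2 ∧ (⋂ i ∈ Q, F i).Nonempty) :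
    ∃ C : Finset V, C.card ≤ 2 * (p - 1) * d ^ 2 ∧ ∀ i, ∃ v ∈ C, v ∈ F i := by
  classical
  obtain ⟨top, dep, htop, hkey⟩ := tops G htree.1 htree.2
  haveI : Nonempty V := htree.1.nonempty
  obtain ⟨q, rfl⟩ : ∃ q, p = q + 1 := ⟨p - 1, by omega⟩
  have hq : 1 ≤ q := by omega
  simp only [Nat.add_sub_cancel]
  have hq' : (1:ℝ) ≤ q := by exact_mod_cast hq
  have hd' : (1:ℝ) ≤ d := by exact_mod_cast hd
  let κ : ι → Type _ := fun i => (G.induce (F i)).ConnectedComponent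
  haveI : ∀ i, Fintype (κ i) := fun i => Fintype.ofFinite _
  let T : ∀ i, κ i → Set V := fun i K => Subtype.val '' K.supp
  have hT : ∀ i K, TCon G (T i K) := fun i K => comp_con G (F i) K
  have hTF : ∀ i K, T i K ⊆ F i := by
    rintro i K _ ⟨a, _, rfl⟩; exact a.2
  have hFT : ∀ i, ∀ v ∈ F i, ∃ K, v ∈ T i K := fun i v hv =>
    ⟨(G.induce (F i)).connectedComponentMk ⟨v, hv⟩, ⟨v, hv⟩, rfl, rfl⟩
  have hcard : ∀ i, (Fintype.card (κ i) : ℝ) ≤ d := by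
    intro i
    rw [← Nat.card_eq_fintype_card]
    exact_mod_cast hcomp i
  -- fractional cover
  obtain ⟨w, hw0, hw1, hwF⟩ := lpd F (1 / (2 * d * q)) (by
    intro x hx m hm
    let R : ι → ι → Prop := fun i j => (F i ∩ F j).Nonempty
    have h1 := wturan R (fun i => by simpa [R] using hne i)
      (fun i j h => by simpa [R, Set.inter_comm] using h) x hx q Finset.univ (by
        intro P _ hP
        obtain ⟨Q, hQ, hc, v, hv⟩ := hp2 P hP
        obtain ⟨a, b, hab, rfl⟩ := Finset.card_eq_two.1 hc
        simp only [Set.mem_iInter] at hv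
        exact ⟨a, hQ (by simp), b, hQ (by simp), hab, v, hv a (by simp), hv b (by simp)⟩)
    let a : ι → ι → ℝ := fun i j => ∑ K : κ i, if top (T i K) ∈ F j then 1 else 0
    have ha0 : ∀ i j, 0 ≤ a i j := fun i j => Finset.sum_nonneg fun K _ => by split_ifs <;> simp
    have ha1 : ∀ i j K, top (T i K) ∈ F j → 1 ≤ a i j := by
      intro i j K hK
      have := Finset.single_le_sum (f := fun K : κ i => if top (T i K) ∈ F j then (1:ℝ) else 0)
        (fun K _ => by split_ifs <;> simp) (Finset.mem_univ K)
      simp only [hK, if_true] at this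
      exact this
    have haR : ∀ i j, R i j → 1 ≤ a i j + a j i := by
      rintro i j ⟨v, hi, hj⟩
      obtain ⟨K, hK⟩ := hFT i v hi
      obtain ⟨L, hL⟩ := hFT j v hj
      rcases le_total (dep (top (T j L))) (dep (top (T i K))) with h | h
      · have := ha1 i j K (hTF j L (hkey _ _ (hT i K) (hT j L) ⟨v, hK, hL⟩ h))
        linarith [ha0 j i]
      · have := ha1 j i L (hTF i K (hkey _ _ (hT j L) (hT i K) ⟨v, hL, hK⟩ h))
        linarith [ha0 i j]
    have hm0 : 0 ≤ m := (Finset.sum_nonneg fun i _ => hx i).trans (hm (Classical.arbitrary V))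
    set X := ∑ i, x i with hX
    have hX0 : 0 ≤ X := Finset.sum_nonneg fun i _ => hx i
    have hrow : ∀ i, ∑ j, a i j * x j ≤ d * m := by
      intro i
      simp only [a, Finset.sum_mul]
      rw [Finset.sum_comm]
      calc _ ≤ ∑ K : κ i, m := Finset.sum_le_sum fun K _ => by
            refine le_trans (le_of_eq ?_) (hm (top (T i K)))
            rw [Finset.sum_filter]
            refine Finset.sum_congr rfl fun j _ => ?_
            split_ifs <;> simp
        _ = Fintype.card (κ i) * m := by simp
        _ ≤ d * m := mul_le_mul_of_nonneg_right (hcard i) hm0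
    have hS : ∑ i, ∑ j, x i * (a i j * x j) ≤ d * m * X := by
      rw [hX, Finset.mul_sum]
      refine Finset.sum_le_sum fun i _ => ?_
      rw [← Finset.mul_sum, mul_comm]
      exact mul_le_mul_of_nonneg_right (hrow i) (hx i)
    have hS' : ∑ i, ∑ j, x i * (a j i * x j) ≤ d * m * X := by
      rw [Finset.sum_comm]
      refine le_trans (le_of_eq ?_) hS
      refine Finset.sum_congr rfl fun i _ => Finset.sum_congr rfl fun j _ => by ring
    have h2 : ∑ i, x i * ∑ j with R i j, x j ≤ 2 * (d * m * X) := by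
      calc _ ≤ ∑ i, ∑ j, (x i * (a i j * x j) + x i * (a j i * x j)) := by
            refine Finset.sum_le_sum fun i _ => ?_
            rw [Finset.sum_filter, Finset.mul_sum]
            refine Finset.sum_le_sum fun j _ => ?_
            have hxx := mul_nonneg (hx i) (hx j)
            split_ifs with h
            · nlinarith [haR i j h]
            · have := mul_nonneg hxx (ha0 i j)
              have := mul_nonneg hxx (ha0 j i)
              nlinarith
        _ ≤ _ := by
            simp only [Finset.sum_add_distrib]
            linarith
    have h3 : X ^ 2 ≤ (2 * d * q * m) * X := by
      refine h1.trans ((mul_le_mul_of_nonneg_left h2 (by positivity)).trans (le_of_eq (by ring)))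
    have h4 : X ≤ 2 * d * q * m := by
      rcases hX0.eq_or_lt with h | h
      · rw [← h]; positivity
      · rw [sq] at h3; exact le_of_mul_le_mul_right h3 h
    rw [one_div, inv_mul_le_iff₀ (by positivity)]
    exact h4)
  -- heavy components
  have hheavy : ∀ i, ∃ K : κ i, 1 / (2 * q * d ^ 2 : ℝ) ≤ ∑ v with v ∈ T i K, w v := by
    intro i
    by_contra hcon
    push Not at hcon
    obtain ⟨v0, hv0⟩ := hne i
    obtain ⟨K0, _⟩ := hFT i v0 hv0
    have h1 : ∑ v with v ∈ F i, w v ≤ ∑ K : κ i, ∑ v with v ∈ T i K, w v := by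
      simp only [Finset.sum_filter]
      rw [Finset.sum_comm]
      refine Finset.sum_le_sum fun v _ => ?_
      have hnn : ∀ K ∈ (Finset.univ : Finset (κ i)), 0 ≤ if v ∈ T i K then w v else 0 :=
        fun K _ => by split_ifs <;> simp [hw0]
      split_ifs with hv
      · obtain ⟨K, hK⟩ := hFT i v hv
        have := Finset.single_le_sum hnn (Finset.mem_univ K)
        simpa [hK] using this
      · exact Finset.sum_nonneg hnn
    have h2 : ∑ K : κ i, ∑ v with v ∈ T i K, w v < ∑ K : κ i, 1 / (2 * q * d ^ 2 : ℝ) :=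
      Finset.sum_lt_sum_of_nonempty ⟨K0, Finset.mem_univ _⟩ fun K _ => hcon K
    have h3 : ∑ K : κ i, 1 / (2 * q * d ^ 2 : ℝ) ≤ d * (1 / (2 * q * d ^ 2 : ℝ)) := by
      rw [Finset.sum_const, nsmul_eq_mul]
      exact mul_le_mul_of_nonneg_right (hcard i) (by positivity)
    have h4 : d * (1 / (2 * q * d ^ 2 : ℝ)) = 1 / (2 * d * q) := by
      field_simp
    have := hwF i
    linarith
  choose K hK using hheavy
  obtain ⟨C, J, -, hCJ, hdis, hpierce⟩ := greedy_s17 (TCon G) top dep htop hkey (fun i => T i (K i))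
    (fun i => hT i (K i)) Finset.univ
  refine ⟨C, hCJ.trans ?_, fun i => ?_⟩
  · have h1 : ∑ i ∈ J, ∑ v with v ∈ T i (K i), w v ≤ 1 := by
      rw [← Finset.sum_biUnion, ← hw1]
      · exact Finset.sum_le_sum_of_subset_of_nonneg (Finset.subset_univ _) fun v _ _ => hw0 v
      · intro i hi j hj hij
        rw [Function.onFun, Finset.disjoint_left]
        intro v hv hv'
        exact Set.disjoint_left.1 (hdis i hi j hj hij) (Finset.mem_filter.1 hv).2
          (Finset.mem_filter.1 hv').2
    have h2 : ∑ i ∈ J, 1 / (2 * q * d ^ 2 : ℝ) ≤ 1 := (Finset.sum_le_sum fun i _ => hK i).trans h1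
    rw [Finset.sum_const, nsmul_eq_mul, mul_one_div, div_le_one (by positivity)] at h2
    exact_mod_cast h2
  · obtain ⟨v, hv, hv'⟩ := hpierce i (Finset.mem_univ i)
    exact ⟨v, hv, hTF i _ hv'⟩
end
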